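/- A periodic orientation-preserving homeomorphism of the 2-sphere with at least three fixed points is the identity. -/

import Mathlib

/-- The 2-sphere, as the unit sphere in Euclidean 3-space. -/
noncomputable abbrev Sphere2 : Set (EuclideanSpace ℝ (Fin 3)) :=
  Metric.sphere (0 : EuclideanSpace ℝ (Fin 3)) 1

/-- A homeomorphism of the sphere is orientation preserving if (as a continuous map)
it is homotopic to the identity, i.e. it has degree `+1`. -/
def OrientPreserving (F : Sphere2 ≃ₜ Sphere2) : Prop :=
  (F : C(Sphere2, Sphere2)).Homotopic (ContinuousMap.id _)

open Complex Set Metric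
open scoped ComplexConjugate

/-- `f` has a continuous logarithm on `E`. -/
def Ex (E : Set ℂ) (f : ℂ → ℂ) : Prop :=
  ∃ h : ℂ → ℂ, ContinuousOn h E ∧ ∀ w ∈ E, f w = exp (h w)

namespace Ex
variable {E E' : Set ℂ} {f f' : ℂ → ℂ}

lemma ne_zero (h : Ex E f) {w : ℂ} (hw : w ∈ E) : f w ≠ 0 := by
  obtain ⟨k, -, hk⟩ := h
  rw [hk w hw]; exact exp_ne_zero _

lemma mono (h : Ex E f) (hs : E' ⊆ E) : Ex E' f := by
  obtain ⟨k, hc, hk⟩ := h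
  exact ⟨k, hc.mono hs, fun w hw => hk w (hs hw)⟩

lemma congr (h : Ex E f) (hs : ∀ w ∈ E, f' w = f w) : Ex E f' := by
  obtain ⟨k, hc, hk⟩ := h
  exact ⟨k, hc, fun w hw => by rw [hs w hw, hk w hw]⟩

lemma mul (h : Ex E f) (h' : Ex E f') : Ex E (fun w => f w * f' w) := by
  obtain ⟨k, hc, hk⟩ := h
  obtain ⟨k', hc', hk'⟩ := h'
  exact ⟨fun w => k w + k' w, hc.add hc', fun w hw => by simp only [hk w hw, hk' w hw, exp_add]⟩

lemma inv (h : Ex E f) : Ex E (fun w => (f w)⁻¹) := by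
  obtain ⟨k, hc, hk⟩ := h
  exact ⟨fun w => - k w, hc.neg, fun w hw => by simp only [hk w hw, exp_neg]⟩

lemma div (h : Ex E f) (h' : Ex E f') : Ex E (fun w => f w / f' w) := by
  simpa [div_eq_mul_inv] using h.mul h'.inv

lemma zpow (h : Ex E f) (n : ℤ) : Ex E (fun w => f w ^ n) := by
  obtain ⟨k, hc, hk⟩ := h
  exact ⟨fun w => n * k w, continuousOn_const.mul hc, fun w hw => by simp only [hk w hw, exp_int_mul]⟩

lemma const {c : ℂ} (hc : c ≠ 0) : Ex E (fun _ => c) :=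
  ⟨fun _ => log c, continuousOn_const, fun w _ => by rw [exp_log hc]⟩

lemma ofExp {b : ℂ → ℂ} (hb : ContinuousOn b E) : Ex E (fun w => exp (b w)) :=
  ⟨b, hb, fun _ _ => rfl⟩

lemma prod {ι : Type*} (S : Finset ι) (F : ι → ℂ → ℂ) (h : ∀ a ∈ S, Ex E (F a)) :
    Ex E (fun w => ∏ a ∈ S, F a w) := by
  classical
  induction S using Finset.induction_on with
  | empty => simpa using const (E := E) one_ne_zero
  | insert a S ha ih =>
    simp only [Finset.prod_insert ha]
    exact (h a (by simp)).mul (ih fun b hb => h b (by simp [hb]))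

lemma comp {φ : ℂ → ℂ} (h : Ex E f) (hφ : ContinuousOn φ E') (hm : MapsTo φ E' E) :
    Ex E' (fun w => f (φ w)) := by
  obtain ⟨k, hc, hk⟩ := h
  exact ⟨fun w => k (φ w), hc.comp hφ hm, fun w hw => hk _ (hm hw)⟩

lemma of_slit (hf : ContinuousOn f E) (h : ∀ w ∈ E, f w ∈ slitPlane) : Ex E f :=
  ⟨fun w => log (f w), hf.clog h, fun w hw => by rw [exp_log (slitPlane_ne_zero (h w hw))]⟩

lemma of_near_one (hf : ContinuousOn f E) (h : ∀ w ∈ E, ‖f w - 1‖ < 1) : Ex E f :=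
  of_slit hf fun w hw => by
    left
    have := (abs_re_le_norm (f w - 1)).trans_lt (h w hw)
    rw [abs_lt] at this
    simp at this
    linarith [this.1]

lemma continuousOn (h : Ex E f) : ContinuousOn f E := by
  obtain ⟨k, hc, hk⟩ := h
  exact (continuous_exp.comp_continuousOn hc).congr hk

lemma of_univ {f : ℂ → ℂ} (hf : Continuous f) (h : ∀ w, f w ≠ 0) : Ex univ f := by
  obtain ⟨F, ⟨-, hF⟩, -⟩ := isCoveringMapOn_exp.existsUnique_continuousMap_lifts
    (⟨f, hf⟩ : C(ℂ, ℂ)) (a₀ := 0) (e₀ := log (f 0)) (exp_log (h 0)) (fun x => h x)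
  exact ⟨F, F.continuous.continuousOn, fun w _ => (congrFun hF w).symm⟩

lemma tietze (hE : IsClosed E) (h : Ex E f) :
    ∃ H : ℂ → ℂ, Continuous H ∧ ∀ w ∈ E, f w = exp (H w) := by
  obtain ⟨k, hc, hk⟩ := h
  obtain ⟨H, hH⟩ := ContinuousMap.exists_restrict_eq hE
    (⟨E.domRestrict k, continuousOn_iff_continuous_domRestrict.mp hc⟩ : C(E, ℂ))
  refine ⟨H, H.continuous, fun w hw => ?_⟩
  rw [hk w hw]
  have := congrArg (fun φ : C(E, ℂ) => φ ⟨w, hw⟩) hH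
  simp at this
  rw [this]

lemma of_closedBall {f : ℂ → ℂ} {c : ℂ} {r : ℝ} (hf : ContinuousOn f (closedBall c r))
    (h : ∀ w ∈ closedBall c r, f w ≠ 0) : Ex (closedBall c r) f := by
  by_cases hr : 0 ≤ r
  swap
  · rw [closedBall_eq_empty.2 (not_le.1 hr)]
    exact ⟨0, by simp, by simp⟩
  -- radial retraction
  let ρ : ℂ → ℂ := fun w => c + (((r / max r ‖w - c‖ : ℝ) : ℂ)) * (w - c)
  rcases hr.eq_or_lt with rfl | hr
  · simp only [closedBall_zero]
    exact ⟨fun _ => log (f c), continuousOn_const, by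
      rintro w rfl
      rw [exp_log (h _ (by simp))]⟩
  have hm : ∀ w, 0 < max r ‖w - c‖ := fun w => lt_max_of_lt_left hr
  have hρ : Continuous ρ := by
    refine continuous_const.add (Continuous.mul ?_ (by fun_prop))
    refine continuous_ofReal.comp ?_
    exact continuous_const.div (by fun_prop) fun w => (hm w).ne'
  have hρm : ∀ w, ρ w ∈ closedBall c r := by
    intro w
    simp only [ρ, mem_closedBall, dist_eq_norm, add_sub_cancel_left, norm_mul, norm_real]
    rw [Real.norm_of_nonneg (by have := hm w; positivity), div_mul_eq_mul_div,
      div_le_iff₀ (hm w)]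
    exact mul_le_mul_of_nonneg_left (le_max_right _ _) hr.le
  have hρi : ∀ w ∈ closedBall c r, ρ w = w := by
    intro w hw
    simp only [mem_closedBall, dist_eq_norm] at hw
    simp [ρ, max_eq_left hw, hr.ne']
  have := of_univ (f := fun w => f (ρ w)) (by
    rw [← continuousOn_univ]
    exact hf.comp hρ.continuousOn fun w _ => hρm w) (fun w => h _ (hρm w))
  exact (this.mono (subset_univ _)).congr fun w hw => by rw [hρi w hw]

lemma sub_div_self {a : ℂ} {R : ℝ} (ha : ‖a‖ < R) : Ex {w | R ≤ ‖w‖} (fun w => (w - a) / w) := by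
  have h0 : ∀ w : ℂ, R ≤ ‖w‖ → w ≠ 0 := fun w hw h => by
    subst h; simp at hw; linarith [norm_nonneg a]
  apply of_near_one
  · exact ContinuousOn.div (by fun_prop) (by fun_prop) fun w hw => h0 w hw
  · intro w hw
    have hw0 := h0 w hw
    rw [show (w - a) / w - 1 = - (a / w) by field_simp; ring, norm_neg, norm_div,
      div_lt_one (norm_pos_iff.2 hw0)]
    exact ha.trans_le hw

lemma const_of_exp_eq {h h' : ℂ → ℂ} (hE : IsPreconnected E) (hc : ContinuousOn h E)
    (hc' : ContinuousOn h' E) (heq : ∀ w ∈ E, exp (h w) = exp (h' w)) {r w : ℂ} (hr : r ∈ E)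
    (hw : w ∈ E) : h w - h' w = h r - h' r := by
  have := Subtype.preconnectedSpace hE
  have key := isCoveringMap_exp.eq_of_comp_eq (A := E) (g₁ := fun x => h x - h' x)
    (g₂ := fun _ => h r - h' r)
    ((continuousOn_iff_continuous_domRestrict.mp hc).sub
      (continuousOn_iff_continuous_domRestrict.mp hc')) continuous_const
    (by
      funext x
      apply Subtype.ext
      simp [exp_sub, heq x x.2, heq r hr]) ⟨r, hr⟩ rfl
  exact congrFun key ⟨w, hw⟩

lemma not_zpow {k : ℤ} (hk : k ≠ 0) {R : ℝ} (hR : 0 < R) : ¬ Ex {w | R ≤ ‖w‖} (fun w => w ^ k) := by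
  rintro ⟨h, hc, he⟩
  -- restrict to the circle, use the real line inside `ℂ`
  let φ : ℂ → ℂ := fun t => (R : ℂ) * exp ((t.re : ℂ) * I)
  have hφ : Continuous φ := by fun_prop
  have hφm : ∀ t, φ t ∈ {w : ℂ | R ≤ ‖w‖} := fun t => by
    simp [φ, norm_exp_ofReal_mul_I, abs_of_pos hR]
  have key := const_of_exp_eq (E := univ) (h := fun t => h (φ t))
    (h' := fun t => (k : ℂ) * (log R + (t.re : ℂ) * I)) isPreconnected_univ
    (hc.comp hφ.continuousOn fun t _ => hφm t) (by fun_prop) (fun t _ => by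
      rw [← he _ (hφm t), exp_int_mul, exp_add, exp_log (by exact_mod_cast hR.ne')])
    (r := 0) (w := (2 * Real.pi : ℝ)) (mem_univ _) (mem_univ _)
  have e1 : φ ((2 * Real.pi : ℝ)) = φ 0 := by simp [φ]
  rw [e1] at key
  simp at key
  exact hk key

end Ex

lemma linear_ex (A : ℂ →L[ℝ] ℂ) (hA : Function.Injective A) :
    ∃ n : ℤ, Ex {0}ᶜ (fun u => A u / u ^ n) := by
  set α : ℂ := (A 1 - I * A I) / 2 with hα
  set β : ℂ := (A 1 + I * A I) / 2 with hβ
  have hAf : ∀ u : ℂ, A u = α * u + β * (starRingEnd ℂ) u := by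
    intro u
    have h1 : u = u.re • (1 : ℂ) + u.im • I := by simp [re_add_im]
    have h2 : A u = u.re * A 1 + u.im * A I := by
      conv_lhs => rw [h1]
      rw [map_add, map_smul, map_smul]; simp
    have h3 : (starRingEnd ℂ) u = u.re - u.im * I := by
      apply Complex.ext <;> simp
    rw [h2, h3, hα, hβ]
    have hu := re_add_im u
    linear_combination (A 1 - I * A I) / 2 * hu + ((u.im : ℂ) * A I) * I_sq
  have hns : ∀ u : ℂ, u ≠ 0 → ‖(starRingEnd ℂ) u / u‖ = 1 := by
    intro u hu
    rw [norm_div, RCLike.norm_conj, div_self (norm_ne_zero_iff.2 hu)]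
  have hne : ‖α‖ ≠ ‖β‖ := by
    intro h
    by_cases ha : α = 0
    · have hb : β = 0 := by simpa [ha] using h.symm
      have : A 1 = A 0 := by rw [hAf, hAf, ha, hb]; simp
      exact one_ne_zero (hA this)
    · obtain ⟨u, hu⟩ := IsAlgClosed.exists_pow_nat_eq (-(β / α)) (n := 2) (by norm_num)
      have hb1 : ‖u‖ ^ 2 = 1 := by
        rw [← norm_pow, hu, norm_neg, norm_div, ← h, div_self (norm_ne_zero_iff.2 ha)]
      have hu1 : u * (starRingEnd ℂ) u = 1 := by
        rw [mul_conj, normSq_eq_norm_sq, hb1]; simp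
      have hu0 : u ≠ 0 := by rintro rfl; simp at hu1
      have : A u = A 0 := by
        rw [hAf, hAf]
        simp
        have e : α * u ^ 2 = - β := by rw [hu]; field_simp
        apply mul_left_cancel₀ hu0
        linear_combination e + β * hu1
      exact hu0 (hA this)
  have hcont : ContinuousOn (fun u : ℂ => (starRingEnd ℂ) u / u) {0}ᶜ :=
    ContinuousOn.div (by fun_prop) (by fun_prop) fun u hu => hu
  rcases lt_or_gt_of_ne hne with h | h
  · -- conjugate type
    have hb : β ≠ 0 := by rintro hb; simp [hb] at h; linarith [norm_nonneg α]
    refine ⟨-1, ?_⟩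
    have h1 : Ex {0}ᶜ (fun u => 1 + α / β * ((starRingEnd ℂ) u / u)⁻¹) := by
      apply Ex.of_near_one
      · refine continuousOn_const.add (continuousOn_const.mul (hcont.inv₀ ?_))
        intro u hu h0
        have := hns u hu
        rw [h0] at this; simp at this
      · intro u hu
        rw [add_sub_cancel_left, norm_mul, norm_inv, hns u hu, norm_div]
        simp
        rwa [div_lt_one (norm_pos_iff.2 hb)]
    have h2 : Ex {0}ᶜ (fun u => ((‖u‖ ^ 2 : ℝ) : ℂ)) := by
      apply Ex.of_slit
      · fun_prop
      · intro u hu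
        left
        rw [ofReal_re]
        have : 0 < ‖u‖ := norm_pos_iff.2 hu
        positivity
    refine (((Ex.const hb).mul h1).mul h2).congr ?_
    intro u hu
    have hu : u ≠ 0 := hu
    have hcu : (starRingEnd ℂ) u ≠ 0 := by simpa using hu
    rw [hAf, ← normSq_eq_norm_sq, ← mul_conj]
    field_simp
    ring
  · have ha : α ≠ 0 := by rintro ha; simp [ha] at h; linarith [norm_nonneg β]
    refine ⟨1, ?_⟩
    have h1 : Ex {0}ᶜ (fun u => 1 + β / α * ((starRingEnd ℂ) u / u)) := by
      apply Ex.of_near_one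
      · exact continuousOn_const.add (continuousOn_const.mul hcont)
      · intro u hu
        rw [add_sub_cancel_left, norm_mul, hns u hu, norm_div, mul_one]
        rwa [div_lt_one (norm_pos_iff.2 ha)]
    refine ((Ex.const ha).mul h1).congr ?_
    intro u hu
    have hu : u ≠ 0 := hu
    rw [hAf]
    field_simp

lemma local_ex {Q : ℂ → ℂ} {A : ℂ →L[ℝ] ℂ} {a : ℂ} (hQc : Continuous Q)
    (hQ : HasFDerivAt Q A a) (h0 : Q a = 0)
    (hA : A.det ≠ 0) :
    ∃ n : ℤ, ∃ ρ > 0, Ex (ball a ρ \ {a}) (fun w => Q w / (w - a) ^ n) := by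
  let A' := A.toContinuousLinearEquivOfDetNeZero hA
  have hAA : ∀ u, A' u = A u := fun u => rfl
  have hinj : Function.Injective A := A'.injective
  obtain ⟨n, hn⟩ := linear_ex A hinj
  obtain ⟨K, hK0, hK⟩ : ∃ K > 0, ∀ u, K * ‖u‖ ≤ ‖A u‖ := by
    refine ⟨(‖(A'.symm : ℂ →L[ℝ] ℂ)‖ + 1)⁻¹, by positivity, fun u => ?_⟩
    have h1 : ‖u‖ ≤ ‖(A'.symm : ℂ →L[ℝ] ℂ)‖ * ‖A u‖ := by
      have := (A'.symm : ℂ →L[ℝ] ℂ).le_opNorm (A u)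
      rwa [← hAA, ContinuousLinearEquiv.coe_coe, A'.symm_apply_apply] at this
    rw [inv_mul_le_iff₀ (by positivity)]
    nlinarith [norm_nonneg (A u)]
  have hlit := (hasFDerivAt_iff_isLittleO_nhds_zero.1 hQ).def (c := K / 2) (by positivity)
  obtain ⟨ρ, hρ, hb⟩ := Metric.eventually_nhds_iff_ball.1 hlit
  refine ⟨n, ρ, hρ, ?_⟩
  have hm : MapsTo (fun w => w - a) (ball a ρ \ {a}) {0}ᶜ := fun w hw => by
    simpa [sub_eq_zero] using hw.2
  have h1 := hn.comp (φ := fun w => w - a) (E' := ball a ρ \ {a}) (by fun_prop) hm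
  have hne : ∀ w ∈ ball a ρ \ {a}, A (w - a) ≠ 0 := fun w hw h => by
    have := hK (w - a)
    rw [h] at this
    have h2 : 0 < ‖w - a‖ := norm_pos_iff.2 (hm hw)
    simp at this
    nlinarith
  have h2 : Ex (ball a ρ \ {a}) (fun w => Q w / A (w - a)) := by
    apply Ex.of_near_one
    · exact hQc.continuousOn.div (by fun_prop) hne
    · intro w hw
      have hw2 := hne w hw
      have h3 := hb (w - a) (by simpa [dist_eq_norm] using hw.1)
      simp only [add_sub_cancel, h0, sub_zero] at h3
      rw [show Q w / A (w - a) - 1 = (Q w - A (w - a)) / A (w - a) by field_simp, norm_div,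
        div_lt_one (norm_pos_iff.2 hw2)]
      have h4 := hK (w - a)
      have h2 : 0 < ‖w - a‖ := norm_pos_iff.2 (hm hw)
      nlinarith
  refine (h2.mul h1).congr ?_
  intro w hw
  have hw2 := hne w hw
  have : w - a ≠ 0 := hm hw
  field_simp

lemma removal {E B : Set ℂ} (hE : IsClosed E) (hB : ∀ f : ℂ → ℂ, ContinuousOn f B →
    (∀ w ∈ B, f w ≠ 0) → Ex B f) (S : Finset ℂ) :
    ∀ F : ℂ → ℂ, ContinuousOn F (B \ S) → (∀ w ∈ B \ S, F w ≠ 0) →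
      (∀ a ∈ S, a ∉ E) →
      (∀ a ∈ S, ∃ n : ℤ, ∃ ρ > 0, Ex (ball a ρ \ {a}) (fun w => F w / (w - a) ^ n)) →
      ∃ n : ℂ → ℤ, Ex (E ∩ B) (fun w => F w / ∏ a ∈ S, (w - a) ^ (n a)) := by
  classical
  induction S using Finset.induction_on with
  | empty =>
    intro F hF h0 _ _
    refine ⟨0, ?_⟩
    simp only [Finset.coe_empty, sdiff_empty] at hF h0
    simpa using (hB F hF h0).mono inter_subset_right
  | insert a S haS ih =>
    intro F hF h0 hSE hloc
    obtain ⟨m, ρ, hρ, k, hkc, hk⟩ := hloc a (by simp)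
    -- choose a smaller radius
    obtain ⟨σ, hσ, hσρ, hσE⟩ : ∃ σ > 0, σ < ρ ∧ closedBall a σ ⊆ (E ∪ S)ᶜ := by
      have hcl : IsClosed (E ∪ (S : Set ℂ)) := hE.union S.finite_toSet.isClosed
      have : (E ∪ (S : Set ℂ))ᶜ ∈ nhds a := hcl.isOpen_compl.mem_nhds (by
        simp [haS, hSE a (by simp)])
      obtain ⟨σ, hσ, h⟩ := Metric.nhds_basis_closedBall.mem_iff.1 this
      exact ⟨min σ (ρ / 2), by positivity, by
        have := min_le_right σ (ρ / 2); linarith,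
        (closedBall_subset_closedBall (min_le_left _ _)).trans h⟩
    have hsph : sphere a σ ⊆ ball a ρ \ {a} := fun w hw => by
      rw [mem_sphere] at hw
      refine ⟨by rw [mem_ball, hw]; exact hσρ, fun h => ?_⟩
      rw [mem_singleton_iff.1 h] at hw; simp at hw; linarith
    obtain ⟨H, hHc, hH⟩ := Ex.tietze isClosed_sphere
      (Ex.mono ⟨k, hkc, hk⟩ hsph)
    set F2 : ℂ → ℂ := fun w => if w ∈ closedBall a σ then exp (H w) else F w / (w - a) ^ m
      with hF2
    have hF2out : ∀ w, w ∉ ball a σ → F2 w = F w / (w - a) ^ m := by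
      intro w hw
      by_cases hw2 : w ∈ closedBall a σ
      · have : w ∈ sphere a σ := by
          rw [mem_sphere]; rw [mem_ball, not_lt] at hw; exact le_antisymm hw2 hw
        rw [hF2]; simp only [if_pos hw2]
        exact (hH w this).symm
      · simp only [hF2, if_neg hw2]
    have hpow : ∀ w, w ≠ a → (w - a) ^ m ≠ 0 := fun w hw => zpow_ne_zero _ (sub_ne_zero.2 hw)
    have hane : ∀ w, w ∉ ball a σ → w ≠ a := by
      rintro w hw rfl; exact hw (mem_ball_self hσ)
    have c1 : ContinuousOn F2 (closedBall a σ) :=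
      (continuous_exp.comp hHc).continuousOn.congr fun w hw => by simp only [hF2, if_pos hw]; rfl
    have c2 : ContinuousOn F2 ((B \ S) ∩ (ball a σ)ᶜ) := by
      have : ContinuousOn (fun w => F w / (w - a) ^ m) ((B \ S) ∩ (ball a σ)ᶜ) := by
        refine ContinuousOn.div (hF.mono ?_) ?_ ?_
        · rintro w ⟨⟨hw1, hw2⟩, hw3⟩
          refine ⟨hw1, ?_⟩
          simp only [Finset.coe_insert, mem_insert_iff, not_or]
          exact ⟨hane w hw3, hw2⟩
        · exact ContinuousOn.zpow₀ (by fun_prop) _ fun w hw => Or.inl (sub_ne_zero.2 (hane w hw.2))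
        · exact fun w hw => hpow w (hane w hw.2)
      exact this.congr fun w hw => hF2out w hw.2
    have c3 : ContinuousOn F2 (B \ S) := by
      intro w hw
      by_cases hwb : w ∈ ball a σ
      · exact (c1.continuousAt (closedBall_mem_nhds_of_mem hwb)).continuousWithinAt
      by_cases hwc : w ∈ closedBall a σ
      · have hu : B \ S ⊆ closedBall a σ ∪ ((B \ S) ∩ (ball a σ)ᶜ) := by
          intro x hx
          by_cases hx2 : x ∈ ball a σ
          · exact Or.inl (ball_subset_closedBall hx2)
          · exact Or.inr ⟨hx, hx2⟩
        exact ((c1 w hwc).union (c2 w ⟨hw, hwb⟩)).mono hu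
      · have hn : (closedBall a σ)ᶜ ∈ nhds w := isClosed_closedBall.isOpen_compl.mem_nhds hwc
        refine (c2 w ⟨hw, hwb⟩).mono_of_mem_nhdsWithin ?_
        refine Filter.mem_of_superset (inter_mem_nhdsWithin _ hn) ?_
        exact inter_subset_inter_right _ (compl_subset_compl.2 ball_subset_closedBall)
    have h3 : ∀ w ∈ B \ S, F2 w ≠ 0 := by
      intro w hw
      by_cases hwb : w ∈ ball a σ
      · simp only [hF2, if_pos (ball_subset_closedBall hwb)]; exact exp_ne_zero _
      · rw [hF2out w hwb]
        refine div_ne_zero (h0 w ⟨hw.1, ?_⟩) (hpow w (hane w hwb))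
        simp only [Finset.coe_insert, mem_insert_iff, not_or]
        exact ⟨hane w hwb, hw.2⟩
    obtain ⟨n, hn⟩ := ih F2 c3 h3 (fun b hb => hSE b (by simp [hb])) (by
      intro b hb
      obtain ⟨l, τ, hτ, hl⟩ := hloc b (by simp [hb])
      have hbn : b ∉ closedBall a σ := fun h => hσE h (Or.inr hb)
      obtain ⟨τ', hτ', ht⟩ := Metric.nhds_basis_closedBall.mem_iff.1
        (isClosed_closedBall.isOpen_compl.mem_nhds hbn)
      refine ⟨l, min τ τ', by positivity, ?_⟩
      have e1 : Ex (closedBall b τ') (fun w => (w - a) ^ m) := by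
        apply Ex.zpow
        refine Ex.of_closedBall (by fun_prop) fun w hw h => ht hw ?_
        rw [sub_eq_zero.1 h]; exact mem_closedBall_self hσ.le
      have e2 := (hl.mono (E' := ball b (min τ τ') \ {b})
        (sdiff_subset_sdiff_left (ball_subset_ball (min_le_left _ _)))).div
        (e1.mono (E' := ball b (min τ τ') \ {b})
        (sdiff_subset.trans (ball_subset_closedBall.trans
          (closedBall_subset_closedBall (min_le_right _ _)))))
      refine e2.congr fun w hw => ?_
      have hwn : w ∉ ball a σ := fun h => ht (ball_subset_closedBall
        (ball_subset_ball (min_le_right _ _) hw.1)) (ball_subset_closedBall h)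
      rw [hF2out w hwn, div_right_comm])
    refine ⟨Function.update n a m, hn.congr fun w hw => ?_⟩
    have hwn : w ∉ ball a σ := fun h => hσE (ball_subset_closedBall h) (Or.inl hw.1)
    rw [hF2out w hwn, Finset.prod_insert haS, Function.update_self, div_div]
    congr 2
    refine Finset.prod_congr rfl fun b hb => ?_
    rw [Function.update_of_ne]
    rintro rfl; exact haS hb

lemma eilenberg {E : Set ℂ} {c : ℂ} {r : ℝ} (hE : IsClosed E) (hEB : E ⊆ closedBall c r)
    {f : ℂ → ℂ} (hf : ContinuousOn f E) (hf0 : ∀ w ∈ E, f w ≠ 0) :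
    ∃ S : Finset ℂ, ∃ n : ℂ → ℤ, (∀ a ∈ S, a ∈ closedBall c r ∧ a ∉ E) ∧
      Ex E (fun w => f w / ∏ a ∈ S, (w - a) ^ (n a)) := by
  have hEc : IsCompact E := (isCompact_closedBall c r).of_isClosed_subset hE hEB
  obtain ⟨f0, hff⟩ := ContinuousMap.exists_restrict_eq hE
    (⟨E.domRestrict f, continuousOn_iff_continuous_domRestrict.mp hf⟩ : C(E, ℂ))
  have hff : ∀ w ∈ E, f0 w = f w := fun w hw =>
    congrArg (fun φ : C(E, ℂ) => φ ⟨w, hw⟩) hff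
  obtain ⟨δ, hδ, hδf⟩ : ∃ δ > 0, ∀ w ∈ E, δ ≤ ‖f w‖ := by
    rcases E.eq_empty_or_nonempty with rfl | hne
    · exact ⟨1, one_pos, by simp⟩
    · obtain ⟨x, hx, hm⟩ := hEc.exists_isMinOn hne hf.norm
      exact ⟨‖f x‖, norm_pos_iff.2 (hf0 x hx), fun w hw => hm hw⟩
  obtain ⟨P, hPs, hPf, -⟩ := f0.continuous.exists_contDiff_approx 1 (ε := fun _ => δ / 4)
    continuous_const (fun _ => by positivity)
  have hPd : Differentiable ℝ P := hPs.differentiable (by simp)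
  -- Sard
  obtain ⟨s, hs, hsr⟩ : ∃ s ∈ ball (0 : ℂ) (δ / 4), s ∉ P '' {x | (fderiv ℝ P x).det = 0} := by
    have h0 : MeasureTheory.volume (P '' {x | (fderiv ℝ P x).det = 0}) = 0 :=
      MeasureTheory.addHaar_image_eq_zero_of_det_fderivWithin_eq_zero _
        (fun x _ => (hPd x).hasFDerivAt.hasFDerivWithinAt) (fun x hx => hx)
    by_contra! hcon
    have h1 : MeasureTheory.volume (ball (0 : ℂ) (δ / 4)) ≤ 0 := by
      rw [← h0]; exact MeasureTheory.measure_mono hcon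
    exact absurd h1 (not_le.2 (measure_ball_pos _ _ (by positivity)))
  set Q : ℂ → ℂ := fun w => P w - s with hQ
  have hQc : Continuous Q := hPs.continuous.sub continuous_const
  have hQloc : ∀ a, Q a = 0 → ∃ n : ℤ, ∃ ρ > 0, Ex (ball a ρ \ {a}) (fun w => Q w / (w - a) ^ n) := by
    intro a ha
    refine local_ex hQc ((hPd a).hasFDerivAt.sub_const s) ha fun h => hsr ⟨a, h, ?_⟩
    exact sub_eq_zero.1 ha
  have hQf : ∀ w ∈ E, ‖Q w - f w‖ < δ / 2 := by
    intro w hw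
    have h1 := hPf w
    rw [hff w hw, dist_eq_norm] at h1
    rw [mem_ball_zero_iff] at hs
    calc ‖Q w - f w‖ = ‖(P w - f w) - s‖ := by rw [hQ]; ring_nf
      _ ≤ ‖P w - f w‖ + ‖s‖ := norm_sub_le _ _
      _ < δ / 2 := by linarith
  have hQE : ∀ w ∈ E, Q w ≠ 0 := fun w hw h => by
    have := hQf w hw
    rw [h, zero_sub, norm_neg] at this
    linarith [hδf w hw]
  have hfin : (closedBall c r ∩ {w | Q w = 0}).Finite := by
    apply IsCompact.finite
    · exact (isCompact_closedBall c r).inter_right (isClosed_eq hQc continuous_const)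
    · rw [isDiscrete_iff_nhdsNE]
      intro a ha
      obtain ⟨n, ρ, hρ, hex⟩ := hQloc a ha.2
      rw [← disjoint_iff, Filter.disjoint_principal_right]
      refine mem_nhdsWithin.2 ⟨ball a ρ, isOpen_ball, mem_ball_self hρ, ?_⟩
      intro w hw hw2
      have := hex.ne_zero hw
      rw [hw2.2] at this
      simp at this
  obtain ⟨n, hn⟩ := removal (E := E) (B := closedBall c r) hE (fun f h1 h2 => Ex.of_closedBall h1 h2)
    hfin.toFinset Q hQc.continuousOn (fun w hw h => hw.2 (by simpa using ⟨hw.1, h⟩))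
    (fun a ha haE => hQE a haE (by simp at ha; exact ha.2))
    (fun a ha => hQloc a (by simp at ha; exact ha.2))
  refine ⟨hfin.toFinset, n, fun a ha => ?_, ?_⟩
  · simp only [Finite.mem_toFinset, mem_inter_iff] at ha
    exact ⟨ha.1, fun h => hQE a h ha.2⟩
  rw [inter_eq_left.2 hEB] at hn
  have h2 : Ex E (fun w => Q w / f w) := by
    apply Ex.of_near_one
    · exact hQc.continuousOn.div hf hf0
    · intro w hw
      have := hf0 w hw
      rw [show Q w / f w - 1 = (Q w - f w) / f w by field_simp, norm_div,
        div_lt_one (norm_pos_iff.2 this)]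
      linarith [hQf w hw, hδf w hw]
  refine (hn.div h2).congr fun w hw => ?_
  have := hQE w hw
  have := hf0 w hw
  field_simp

/-- `g` preserves orientation: infinitesimal-free formulation through logarithms. -/
def OP (g : ℂ → ℂ) : Prop := ∀ q : ℂ, Ex {q}ᶜ (fun w => (g w - g q) / (w - q))

lemma invariant_fix {g : ℂ → ℂ} (hg : Continuous g) {p : ℕ} (hp : 0 < p)
    (hper : ∀ w, g^[p] w = w) {Z : Set ℂ} (hZ : Z.Finite) (hgZ : ∀ w, w ∉ Z → g w ∉ Z)
    {u : ℂ → ℂ} (hu0 : ∀ w, w ∉ Z → u w ≠ 0) (hu : Ex Zᶜ (fun w => u (g w) / u w))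
    {r : ℂ} (hr : r ∉ Z) (hgr : g r = r) :
    ∃ β : ℂ → ℂ, ContinuousOn β Zᶜ ∧ ∀ w ∉ Z, u (g w) * exp (β (g w)) = u w * exp (β w) := by
  obtain ⟨a, hac, ha⟩ := hu
  have hua : ∀ w ∉ Z, u (g w) = u w * exp (a w) := fun w hw => by
    rw [← ha w hw]; field_simp [hu0 w hw]
  have hit : ∀ (i : ℕ) w, w ∉ Z → g^[i] w ∉ Z := by
    intro i
    induction i with
    | zero => exact fun w hw => hw
    | succ i ih => exact fun w hw => by rw [Function.iterate_succ_apply']; exact hgZ _ (ih w hw)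
  have hra : exp (a r) = 1 := by
    have h := hua r hr
    rw [hgr] at h
    have := hu0 r hr
    exact (mul_left_cancel₀ this (by rw [← h, mul_one])).symm
  have hir : ∀ i, g^[i] r = r := fun i => Function.iterate_fixed hgr i
  -- normalise
  let b : ℂ → ℂ := fun w => a w - a r
  have hub : ∀ w ∉ Z, u (g w) = u w * exp (b w) := fun w hw => by
    simp only [b, exp_sub, hra, div_one]; exact hua w hw
  have hbc : ContinuousOn b Zᶜ := hac.sub continuousOn_const
  have hbic : ∀ i, ContinuousOn (fun w => b (g^[i] w)) Zᶜ := fun i =>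
    hbc.comp (hg.iterate i).continuousOn fun w hw => hit i w hw
  let S : ℕ → ℂ → ℂ := fun j w => ∑ i ∈ Finset.range j, b (g^[i] w)
  have hSc : ∀ j, ContinuousOn (S j) Zᶜ := fun j => continuousOn_finsetSum _ fun i _ => hbic i
  have hSu : ∀ j, ∀ w ∉ Z, u (g^[j] w) = u w * exp (S j w) := by
    intro j w hw
    induction j with
    | zero => simp [S]
    | succ j ih =>
      rw [Function.iterate_succ_apply', hub _ (hit j w hw), ih]
      simp only [S, Finset.sum_range_succ, exp_add]; ring
  have hconn : IsPreconnected Zᶜ :=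
    (hZ.countable.isPathConnected_compl_of_one_lt_rank (by
      rw [Complex.rank_real_complex]; norm_num)).isConnected.isPreconnected
  have hSp : ∀ w ∉ Z, S p w = 0 := by
    intro w hw
    have := Ex.const_of_exp_eq hconn (hSc p) (h' := fun _ => 0) continuousOn_const (fun w hw => by
      have h := hSu p w hw
      rw [hper] at h
      rw [exp_zero]
      exact (mul_left_cancel₀ (hu0 w hw) (by rw [← h, mul_one])).symm) (r := r) (w := w) hr hw
    simp only [sub_zero] at this
    rw [this]
    simp [S, hir, b]
  have hSs : ∀ j w, S j (g w) = S (j + 1) w - b w := by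
    intro j w
    simp only [S, Finset.sum_range_succ', Function.iterate_succ_apply, Function.iterate_zero, id]
    ring
  refine ⟨fun w => (p : ℂ)⁻¹ * ∑ j ∈ Finset.range p, S j w,
    continuousOn_const.mul (continuousOn_finsetSum _ fun j _ => hSc j), fun w hw => ?_⟩
  have key : (p : ℂ)⁻¹ * ∑ j ∈ Finset.range p, S j (g w)
      = (p : ℂ)⁻¹ * ∑ j ∈ Finset.range p, S j w - b w := by
    simp only [hSs, Finset.sum_sub_distrib]
    have h1 := Finset.sum_range_succ (fun j => S j w) p
    rw [Finset.sum_range_succ', hSp w hw] at h1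
    have h2 : S 0 w = 0 := by simp [S]
    simp only [h2, add_zero] at h1
    rw [h1]
    simp
    have : (p : ℂ) ≠ 0 := by exact_mod_cast hp.ne'
    field_simp
  beta_reduce
  rw [key, hub w hw, mul_assoc, ← exp_add, add_sub_cancel]

lemma prod_zpow_sum {w : ℂ} (hw : w ≠ 0) (p : ℕ) (S : Finset ℂ) (n : ℂ → ℤ) :
    ∏ a ∈ S, (w ^ p) ^ n a = w ^ ((∑ a ∈ S, n a) * (p : ℤ)) := by
  classical
  induction S using Finset.induction_on with
  | empty => simp
  | insert a S ha ih =>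
    rw [Finset.prod_insert ha, Finset.sum_insert ha, ih, add_mul, zpow_add₀ hw, ← zpow_natCast,
      ← zpow_mul, mul_comm (n a)]

section main
variable {g : ℂ → ℂ} {p : ℕ}

lemma iter_mod (hper : ∀ w, g^[p] w = w) {i : ℕ} (hi : i ≤ p) (w : ℂ) :
    g^[p - i] (g^[i] w) = w := by
  rw [← Function.iterate_add_apply, Nat.sub_add_cancel hi, hper]

lemma orbit_fn (hg : Continuous g) (hgi : Function.Injective g) (hp : 0 < p)
    (hper : ∀ w, g^[p] w = w) (hOP : OP g) {r : ℂ} (hr : g r = r) (a : ℂ) (har : a ≠ r) :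
    ∃ β : ℂ → ℂ, ContinuousOn β {w | ∀ i < p, w ≠ g^[i] a} ∧
      ∀ w, (∀ i < p, w ≠ g^[i] a) →
        (∏ i ∈ Finset.range p, (g w - g^[i] a)) * exp (β (g w))
          = (∏ i ∈ Finset.range p, (w - g^[i] a)) * exp (β w) := by
  let Z : Set ℂ := (fun i => g^[i] a) '' (Finset.range p : Set ℕ)
  have hZ : ∀ w, w ∉ Z ↔ ∀ i < p, w ≠ g^[i] a := by
    intro w
    simp only [Z, mem_image, Finset.coe_range, mem_Iio, not_exists, not_and]
    exact forall₂_congr fun i _ => ⟨fun h h' => h h'.symm, fun h h' => h h'.symm⟩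
  have hset : {w | ∀ i < p, w ≠ g^[i] a} = Zᶜ := by
    ext w; exact (hZ w).symm
  have hshift : ∀ w, ∏ i ∈ Finset.range p, (w - g (g^[i] a)) = ∏ i ∈ Finset.range p, (w - g^[i] a) := by
    intro w
    have h1 := Finset.prod_range_succ (fun i => (w - g^[i] a)) p
    have h2 := Finset.prod_range_succ' (fun i => (w - g^[i] a)) p
    obtain ⟨k, rfl⟩ : ∃ k, p = k + 1 := ⟨p - 1, by omega⟩
    rw [Finset.prod_range_succ, Finset.prod_range_succ']
    simp only [← Function.iterate_succ_apply' g, hper, Function.iterate_zero, id]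
  have hir : ∀ i, g^[i] r = r := fun i => Function.iterate_fixed hr i
  have := invariant_fix hg hp hper (Z := Z) ((Finset.finite_toSet _).image _)
    (by
      intro w hw
      rw [hZ] at hw ⊢
      intro i hi h
      rcases i with _ | i
      · refine hw (p - 1) (by omega) (hgi ?_)
        rw [h, ← Function.iterate_succ_apply' g, Nat.succ_eq_add_one, Nat.sub_add_cancel hp, hper]
        rfl
      · rw [Function.iterate_succ_apply'] at h
        exact hw i (by omega) (hgi h))
    (u := fun w => ∏ i ∈ Finset.range p, (w - g^[i] a))
    (by
      intro w hw
      rw [hZ] at hw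
      exact Finset.prod_ne_zero_iff.2 fun i hi => sub_ne_zero.2 (hw i (Finset.mem_range.1 hi)))
    (by
      refine (Ex.prod (Finset.range p) (fun i w => (g w - g (g^[i] a)) / (w - g^[i] a))
        (fun i hi => (hOP (g^[i] a)).mono ?_)).congr fun w hw => ?_
      · intro w hw
        exact (hZ w).1 hw i (Finset.mem_range.1 hi)
      · simp only [Finset.prod_div_distrib, hshift])
    (r := r) (by
      rw [hZ]
      intro i hi h
      apply har
      have : g^[i] a = g^[i] r := by rw [hir, ← h]
      exact (hgi.iterate i) this) hr
  obtain ⟨β, hβ, h⟩ := this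
  exact ⟨β, hset ▸ hβ, fun w hw => h w ((hZ w).2 hw)⟩

/-- State of the induction. -/
def St (g : ℂ → ℂ) (p : ℕ) (E : Set ℂ) : Prop :=
  IsClosed E ∧ (∀ w ∈ E, g w ∈ E) ∧ ∃ f : ℂ → ℂ, ContinuousOn f E ∧ (∀ w ∈ E, f w ≠ 0) ∧
    (∀ w ∈ E, f (g w) = f w) ∧ ∃ R > 0, ∃ N : ℤ, (∀ w : ℂ, R ≤ ‖w‖ → w ∈ E) ∧
      Ex {w | R ≤ ‖w‖} (fun w => f w / w ^ (N * p + 1))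

lemma step (hg : Continuous g) (hgi : Function.Injective g) (hp : 2 ≤ p)
    (hper : ∀ w, g^[p] w = w) (hOP : OP g) {r : ℂ} (hr : g r = r) {E : Set ℂ} (hE : St g p E)
    {c : ℂ} {s : ℝ} (hB : ∀ i, 0 < i → i < p → ∀ w ∈ closedBall c s, g^[i] w ∉ closedBall c s) :
    St g p (E ∪ ⋃ i ∈ Finset.range p, {w | g^[i] w ∈ closedBall c s}) := by
  classical
  obtain ⟨hEc, hEg, f, hfc, hf0, hfg, R, hR, N, hRE, hfR⟩ := hE
  have hEi : ∀ (i : ℕ) w, w ∈ E → g^[i] w ∈ E := by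
    intro i
    induction i with
    | zero => exact fun w hw => hw
    | succ i ih => exact fun w hw => by rw [Function.iterate_succ_apply']; exact hEg _ (ih w hw)
  set B := closedBall c s with hBdef
  obtain ⟨S, n, hS, hEx⟩ := eilenberg (E := E ∩ B) (c := c) (r := s)
    (hEc.inter isClosed_closedBall) inter_subset_right (hfc.mono inter_subset_left)
    (fun w hw => hf0 w hw.1)
  have hSr : ∀ a ∈ S, a ≠ r := by
    rintro a ha rfl
    exact hB 1 one_pos (by omega) a (hS a ha).1 (by rw [Function.iterate_one, hr]; exact (hS a ha).1)
  have hSE : ∀ a ∈ S, ∀ i < p, ∀ w ∈ E, w ≠ g^[i] a := by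
    intro a ha i hi w hw h
    refine (hS a ha).2 ⟨?_, (hS a ha).1⟩
    rw [← iter_mod hper hi.le a, ← h]
    exact hEi _ _ hw
  have hβ : ∀ a : ℂ, ∃ β : ℂ → ℂ, a ∈ S → ContinuousOn β {w | ∀ i < p, w ≠ g^[i] a} ∧
      ∀ w, (∀ i < p, w ≠ g^[i] a) →
        (∏ i ∈ Finset.range p, (g w - g^[i] a)) * exp (β (g w))
          = (∏ i ∈ Finset.range p, (w - g^[i] a)) * exp (β w) := by
    intro a
    by_cases ha : a ∈ S
    · obtain ⟨β, h⟩ := orbit_fn hg hgi (by omega) hper hOP hr a (hSr a ha)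
      exact ⟨β, fun _ => h⟩
    · exact ⟨0, fun h => absurd h ha⟩
  choose β hβ using hβ
  let v : ℂ → ℂ → ℂ := fun a w => (∏ i ∈ Finset.range p, (w - g^[i] a)) * exp (β a w)
  have hv0 : ∀ a ∈ S, ∀ w ∈ E, v a w ≠ 0 := fun a ha w hw =>
    mul_ne_zero (Finset.prod_ne_zero_iff.2 fun i hi =>
      sub_ne_zero.2 (hSE a ha i (Finset.mem_range.1 hi) w hw)) (exp_ne_zero _)
  have hβc : ∀ a ∈ S, ContinuousOn (β a) E := fun a ha =>
    ((hβ a ha).1).mono fun w hw i hi => hSE a ha i hi w hw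
  have hvc : ∀ a ∈ S, ContinuousOn (v a) E := fun a ha => by
    refine ContinuousOn.mul (by fun_prop) (continuous_exp.comp_continuousOn (hβc a ha))
  have hvg : ∀ a ∈ S, ∀ w ∈ E, v a (g w) = v a w := fun a ha w hw =>
    (hβ a ha).2 w fun i hi => hSE a ha i hi w hw
  let f1 : ℂ → ℂ := fun w => f w / ∏ a ∈ S, v a w ^ n a
  have hp0 : ∀ w ∈ E, ∏ a ∈ S, v a w ^ n a ≠ 0 := fun w hw =>
    Finset.prod_ne_zero_iff.2 fun a ha => zpow_ne_zero _ (hv0 a ha w hw)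
  have hf1c : ContinuousOn f1 E := by
    refine hfc.div (continuousOn_finsetProd _ fun a ha => ?_) hp0
    exact (hvc a ha).zpow₀ _ fun w hw => Or.inl (hv0 a ha w hw)
  have hf10 : ∀ w ∈ E, f1 w ≠ 0 := fun w hw => div_ne_zero (hf0 w hw) (hp0 w hw)
  have hf1g : ∀ w ∈ E, f1 (g w) = f1 w := fun w hw => by
    simp only [f1]
    rw [hfg w hw, Finset.prod_congr rfl fun a ha => by rw [hvg a ha w hw]]
  have hf1i : ∀ (i : ℕ), ∀ w ∈ E, f1 (g^[i] w) = f1 w := by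
    intro i
    induction i with
    | zero => exact fun w hw => rfl
    | succ i ih =>
        intro w hw
        rw [Function.iterate_succ_apply', hf1g _ (hEi _ _ hw), ih w hw]
  have hvEx : ∀ a ∈ S, Ex (E ∩ B) (fun w => v a w / (w - a)) := by
    intro a ha
    have e1 : Ex B (fun w => ∏ i ∈ (Finset.range p).erase 0, (w - g^[i] a)) := by
      refine Ex.prod _ (fun i w => w - g^[i] a) fun i hi => ?_
      rw [Finset.mem_erase, Finset.mem_range] at hi
      refine Ex.of_closedBall (by fun_prop) fun w hw h => ?_
      rw [sub_eq_zero] at h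
      rw [h] at hw
      exact hB i (by omega) hi.2 a (hS a ha).1 hw
    refine ((e1.mono inter_subset_right).mul
      (Ex.ofExp ((hβc a ha).mono inter_subset_left))).congr fun w hw => ?_
    have hwa : w - a ≠ 0 := sub_ne_zero.2 (hSE a ha 0 (by omega) w hw.1)
    simp only [v]
    rw [← Finset.mul_prod_erase (Finset.range p) _ (Finset.mem_range.2 (by omega : 0 < p))]
    simp only [Function.iterate_zero, id]
    field_simp
  have hf1Ex : Ex (E ∩ B) f1 := by
    refine (hEx.div (Ex.prod S (fun a w => (v a w / (w - a)) ^ n a)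
      fun a ha => (hvEx a ha).zpow _)).congr fun w hw => ?_
    have hq : ∏ a ∈ S, (w - a) ^ n a ≠ 0 := Finset.prod_ne_zero_iff.2 fun a ha =>
      zpow_ne_zero _ (sub_ne_zero.2 (hSE a ha 0 (by omega) w hw.1))
    have := hp0 w hw.1
    simp only [f1, div_zpow, Finset.prod_div_distrib]
    field_simp
  obtain ⟨H, hHc, hH⟩ := hf1Ex.tietze (hEc.inter isClosed_closedBall)
  let f2 : ℂ → ℂ := fun w => if w ∈ E then f1 w else
    if h : ∃ i, i < p ∧ g^[i] w ∈ B then exp (H (g^[h.choose] w)) else 1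
  have hf2E : ∀ w ∈ E, f2 w = f1 w := fun w hw => by simp only [f2, if_pos hw]
  have huniq : ∀ w i j, i < j → j < p → g^[i] w ∈ B → g^[j] w ∉ B := by
    intro w i j hij hj hi
    have := hB (j - i) (by omega) (by omega) _ hi
    rwa [← Function.iterate_add_apply, Nat.sub_add_cancel hij.le] at this
  have hf2B : ∀ j < p, ∀ w, g^[j] w ∈ B → f2 w = exp (H (g^[j] w)) := by
    intro j hj w hw
    by_cases hwE : w ∈ E
    · rw [hf2E w hwE, ← hf1i j w hwE, hH _ ⟨hEi j w hwE, hw⟩]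
    · have hex : ∃ i, i < p ∧ g^[i] w ∈ B := ⟨j, hj, hw⟩
      simp only [f2, if_neg hwE, dif_pos hex]
      have hc := hex.choose_spec
      have : hex.choose = j := by
        rcases lt_trichotomy hex.choose j with h | h | h
        · exact absurd hw (huniq w _ _ h hj hc.2)
        · exact h
        · exact absurd hc.2 (huniq w _ _ h hc.1 hw)
      rw [this]
  have hTc : ∀ i, IsClosed {w | g^[i] w ∈ B} := fun i =>
    isClosed_closedBall.preimage (hg.iterate i)
  have hUc : IsClosed (⋃ i ∈ Finset.range p, {w | g^[i] w ∈ B}) :=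
    isClosed_biUnion_finset fun i _ => hTc i
  have hmemU : ∀ w, w ∈ (⋃ i ∈ Finset.range p, {w | g^[i] w ∈ B}) ↔ ∃ i < p, g^[i] w ∈ B := by
    intro w; simp
  -- shifting
  have hshift : ∀ w, (∃ i < p, g^[i] w ∈ B) → ∃ i < p, ∃ j < p, g^[i] w ∈ B ∧
      g^[j] (g w) = g^[i] w := by
    rintro w ⟨i, hi, hw⟩
    rcases i with _ | i
    · refine ⟨0, hi, p - 1, by omega, hw, ?_⟩
      rw [← Function.iterate_succ_apply, Nat.succ_eq_add_one, Nat.sub_add_cancel (by omega), hper]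
      rfl
    · exact ⟨i + 1, hi, i, by omega, hw, by rw [Function.iterate_succ_apply]⟩
  refine ⟨hEc.union hUc, ?_, f2, ?_, ?_, ?_, ?_⟩
  · rintro w (hw | hw)
    · exact Or.inl (hEg w hw)
    · right
      rw [hmemU] at hw ⊢
      obtain ⟨i, hi, j, hj, h1, h2⟩ := hshift w hw
      exact ⟨j, hj, h2 ▸ h1⟩
  · refine ContinuousOn.union_of_isClosed (hf1c.congr hf2E) ?_ hEc hUc
    have : ∀ T : Finset ℕ, T ⊆ Finset.range p →
        ContinuousOn f2 (⋃ i ∈ T, {w | g^[i] w ∈ B}) := by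
      intro T
      induction T using Finset.induction_on with
      | empty => intro _; simp
      | insert j T hj ih =>
        intro hT
        rw [Finset.set_biUnion_insert]
        refine ContinuousOn.union_of_isClosed ?_ (ih ((Finset.subset_insert _ _).trans hT))
          (hTc j) (isClosed_biUnion_finset fun i _ => hTc i)
        have hj2 : j < p := Finset.mem_range.1 (hT (Finset.mem_insert_self _ _))
        exact ((continuous_exp.comp hHc).comp (hg.iterate j)).continuousOn.congr
          fun w hw => hf2B j hj2 w hw
    exact this _ subset_rfl
  · rintro w (hw | hw)
    · rw [hf2E w hw]; exact hf10 w hw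
    · rw [hmemU] at hw
      obtain ⟨i, hi, hw⟩ := hw
      rw [hf2B i hi w hw]; exact exp_ne_zero _
  · rintro w (hw | hw)
    · rw [hf2E w hw, hf2E _ (hEg w hw), hf1g w hw]
    · rw [hmemU] at hw
      obtain ⟨i, hi, j, hj, h1, h2⟩ := hshift w hw
      rw [hf2B i hi w h1, hf2B j hj (g w) (h2 ▸ h1), h2]
  · set R' : ℝ := R + 1 + ∑ a ∈ S, ∑ i ∈ Finset.range p, ‖g^[i] a‖ with hR'
    have hnn : 0 ≤ ∑ a ∈ S, ∑ i ∈ Finset.range p, ‖g^[i] a‖ :=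
      Finset.sum_nonneg fun a _ => Finset.sum_nonneg fun i _ => norm_nonneg _
    have hlt : ∀ a ∈ S, ∀ i < p, ‖g^[i] a‖ < R' := by
      intro a ha i hi
      have h1 := Finset.single_le_sum (f := fun i => ‖g^[i] a‖) (fun i _ => norm_nonneg _)
        (Finset.mem_range.2 hi)
      have h2 := Finset.single_le_sum (f := fun a => ∑ i ∈ Finset.range p, ‖g^[i] a‖)
        (fun i _ => Finset.sum_nonneg fun i _ => norm_nonneg _) ha
      linarith
    have hsub : {w : ℂ | R' ≤ ‖w‖} ⊆ {w | R ≤ ‖w‖} := fun w hw => by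
      have : R' ≤ ‖w‖ := hw
      show R ≤ ‖w‖
      linarith
    refine ⟨R', by positivity, N - ∑ a ∈ S, n a, fun w hw => Or.inl (hRE w (hsub hw)), ?_⟩
    have hv : ∀ a ∈ S, Ex {w | R' ≤ ‖w‖} (fun w => v a w / w ^ p) := by
      intro a ha
      refine ((Ex.prod (Finset.range p) (fun i w => (w - g^[i] a) / w) fun i hi =>
        Ex.sub_div_self (hlt a ha i (Finset.mem_range.1 hi))).mul
        (Ex.ofExp ((hβc a ha).mono fun w hw => hRE w (hsub hw)))).congr fun w hw => ?_
      simp only [v, Finset.prod_div_distrib, Finset.prod_const, Finset.card_range]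
      ring
    refine ((hfR.mono hsub).div (Ex.prod S (fun a w => (v a w / w ^ p) ^ n a)
      fun a ha => (hv a ha).zpow _)).congr fun w hw => ?_
    have hw0 : w ≠ 0 := by
      rintro rfl
      have : R' ≤ ‖(0 : ℂ)‖ := hw
      rw [norm_zero] at this
      linarith
    rw [hf2E w (hRE w (hsub hw))]
    simp only [f1, div_zpow, Finset.prod_div_distrib]
    have e1 : ∏ a ∈ S, (w ^ p) ^ n a = w ^ ((∑ a ∈ S, n a) * p) := by
      exact prod_zpow_sum hw0 p S n
    rw [e1, sub_mul, show N * (p : ℤ) - (∑ a ∈ S, n a) * p + 1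
      = (N * p + 1) - (∑ a ∈ S, n a) * p by ring, zpow_sub₀ hw0]
    have h1 := hp0 w (hRE w (hsub hw))
    have h2 := zpow_ne_zero (N * p + 1) hw0
    have h3 := zpow_ne_zero ((∑ a ∈ S, n a) * p) hw0
    field_simp

end main

section planar
variable {g : ℂ → ℂ} {p : ℕ}

lemma far_out (hg : Continuous g) (hper : ∀ w, g^[p] w = w) {B : Set ℂ}
    (hB : Bornology.IsBounded B) :
    ∃ R > 0, ∀ w : ℂ, R ≤ ‖w‖ → ∀ i < p, g^[i] w ∉ B := by
  obtain ⟨M, hM⟩ := hB.subset_closedBall 0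
  have hK : IsCompact (⋃ i ∈ Finset.range p, g^[p - i] '' closedBall 0 M) :=
    (Finset.range p).isCompact_biUnion fun i _ =>
      (isCompact_closedBall _ _).image (hg.iterate _)
  obtain ⟨R, hR⟩ := hK.isBounded.subset_closedBall 0
  refine ⟨|R| + 1, by positivity, fun w hw i hi hwB => ?_⟩
  have : w ∈ closedBall (0 : ℂ) R := hR (by
    simp only [mem_iUnion]
    exact ⟨i, Finset.mem_range.2 hi, g^[i] w, hM hwB, iter_mod hper hi.le w⟩)
  rw [mem_closedBall_zero_iff] at this
  linarith [le_abs_self R]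

lemma free_ball (hg : Continuous g) (hp : p.Prime) (hper : ∀ w, g^[p] w = w) {z : ℂ}
    (hz : g z ≠ z) : ∃ ρ > 0, ∀ i, 0 < i → i < p → ∀ w ∈ closedBall z ρ,
      g^[i] w ∉ closedBall z ρ := by
  have hfree : ∀ i, 0 < i → i < p → g^[i] z ≠ z := by
    intro i hi hip h
    have h1 : Function.minimalPeriod g z ∣ p :=
      Function.IsPeriodicPt.minimalPeriod_dvd (hper z)
    have h2 : Function.minimalPeriod g z ∣ i :=
      Function.IsPeriodicPt.minimalPeriod_dvd h
    rcases (Nat.dvd_prime hp).1 h1 with h | h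
    · exact hz (Function.minimalPeriod_eq_one_iff_isFixedPt.1 h)
    · rw [h] at h2
      exact absurd (Nat.le_of_dvd hi h2) (by omega)
  have key : ∀ i ∈ Finset.range p, ∀ᶠ ρ in nhdsWithin (0 : ℝ) (Ioi 0), 0 < i →
      ∀ w ∈ closedBall z ρ, g^[i] w ∉ closedBall z ρ := by
    intro i hi
    by_cases h0 : 0 < i
    swap
    · exact Filter.Eventually.of_forall fun _ h => absurd h h0
    have hd : 0 < dist (g^[i] z) z := dist_pos.2 (hfree i h0 (Finset.mem_range.1 hi))
    obtain ⟨δ, hδ, h⟩ := Metric.continuous_iff.1 (hg.iterate i) z (dist (g^[i] z) z / 2)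
      (by positivity)
    filter_upwards [Ioo_mem_nhdsGT (lt_min hδ (half_pos hd))] with ρ hρ _ w hw hw'
    rw [mem_closedBall] at hw hw'
    have h1 := h w (lt_of_le_of_lt hw (hρ.2.trans_le (min_le_left _ _)))
    have h2 := hρ.2.trans_le (min_le_right _ _)
    have h3 := dist_triangle_left (g^[i] z) z (g^[i] w)
    linarith
  have := ((Filter.eventually_all_finset (Finset.range p)).2 key).and
    (self_mem_nhdsWithin)
  obtain ⟨ρ, h1, h2⟩ := this.exists
  exact ⟨ρ, h2, fun i h0 hi => h1 i (Finset.mem_range.2 hi) h0⟩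

lemma planar_prime (hg : Continuous g) (hgi : Function.Injective g) (hp : p.Prime)
    (hper : ∀ w, g^[p] w = w) (hOP : OP g) {r r' : ℂ} (hrr : r' ≠ r) (hr : g r = r)
    (hr' : g r' = r') (c : ℂ) : g c = c := by
  classical
  by_contra hc
  have hp2 := hp.two_le
  have hp0 := hp.pos
  obtain ⟨β, hβ, hΦ⟩ := invariant_fix (Z := {r}) (u := fun w => w - r) hg hp0 hper
    (finite_singleton r) (fun w hw h => hw (hgi (by rw [hr]; exact h)))
    (fun w hw => sub_ne_zero.2 hw) ((hOP r).congr fun w hw => by rw [hr]) hrr hr'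
  set R0 : ℝ := ‖r‖ + ‖c‖ + 1 with hR0
  have hrR : ‖r‖ < R0 := by have := norm_nonneg c; linarith
  have hcR : ‖c‖ < R0 := by have := norm_nonneg r; linarith
  have hR0p : 0 < R0 := by positivity
  let Out : Set ℂ := {w | ∀ i < p, R0 ≤ ‖g^[i] w‖}
  have hOutc : IsClosed Out := by
    simp only [Out, setOf_forall]
    exact isClosed_iInter fun i => isClosed_iInter fun _ =>
      isClosed_le continuous_const (hg.iterate i).norm
  have hper' : ∀ i w, g^[i] (g w) = if i + 1 < p then g^[i + 1] w else g^[i] (g w) := by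
    intro i w; split_ifs <;> simp
  have hsh : ∀ (A : Set ℂ) w, (∀ i < p, g^[i] w ∈ A) → ∀ i < p, g^[i] (g w) ∈ A := by
    intro A w h i hi
    rw [← Function.iterate_succ_apply]
    rcases Nat.lt_or_ge (i + 1) p with h1 | h1
    · exact h _ h1
    · have : i.succ = p := by omega
      rw [this, hper]; exact h 0 hp0
  have hOutg : ∀ w ∈ Out, g w ∈ Out := fun w hw => hsh {w | R0 ≤ ‖w‖} w hw
  have hOutR : Out ⊆ {w | R0 ≤ ‖w‖} := fun w hw => hw 0 hp0
  have hner : ∀ w : ℂ, R0 ≤ ‖w‖ → w ≠ r := by rintro w hw rfl; linarith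
  have hnec : ∀ w : ℂ, R0 ≤ ‖w‖ → w ≠ c := by rintro w hw rfl; linarith
  have hne0 : ∀ w : ℂ, R0 ≤ ‖w‖ → w ≠ 0 := by rintro w hw rfl; rw [norm_zero] at hw; linarith
  have hEx : Ex {w : ℂ | R0 ≤ ‖w‖} (fun w => ((w - r) / w) * exp (β w)) :=
    (Ex.sub_div_self hrR).mul (Ex.ofExp (hβ.mono fun w hw => hner w hw))
  obtain ⟨H, hH, hHe⟩ := ((hEx.div (Ex.sub_div_self hcR)).mono hOutR).tietze hOutc
  let f0 : ℂ → ℂ := fun w => (w - c) * exp (H w)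
  have hf0c : Continuous f0 := by fun_prop
  have hf0Out : ∀ w ∈ Out, f0 w = (w - r) * exp (β w) := by
    intro w hw
    simp only [f0]
    rw [← hHe w hw]
    have h1 := hne0 w (hOutR hw)
    have h2 := sub_ne_zero.2 (hnec w (hOutR hw))
    field_simp
  let f1 : ℂ → ℂ := fun w => (p : ℂ)⁻¹ * ∑ i ∈ Finset.range p, f0 (g^[i] w)
  have hpC : (p : ℂ) ≠ 0 := by exact_mod_cast hp0.ne'
  have hf1c : Continuous f1 := by
    refine continuous_const.mul (continuous_finset_sum _ fun i _ => hf0c.comp (hg.iterate i))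
  have hf1g : ∀ w, f1 (g w) = f1 w := by
    intro w
    simp only [f1]
    congr 1
    have h1 := Finset.sum_range_succ (fun i => f0 (g^[i] w)) p
    rw [Finset.sum_range_succ'] at h1
    simp only [hper, Function.iterate_zero, id] at h1
    simpa [Function.iterate_succ_apply] using add_right_cancel h1
  have hΦi : ∀ i, ∀ w ∈ Out, (g^[i] w - r) * exp (β (g^[i] w)) = (w - r) * exp (β w) ∧
      g^[i] w ∈ Out := by
    intro i w hw
    induction i with
    | zero => exact ⟨rfl, hw⟩
    | succ i ih =>
      rw [Function.iterate_succ_apply']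
      exact ⟨(hΦ _ (hner _ (hOutR ih.2))).trans ih.1, hOutg _ ih.2⟩
  have hf1Out : ∀ w ∈ Out, f1 w = (w - r) * exp (β w) := by
    intro w hw
    simp only [f1]
    rw [Finset.sum_congr rfl fun i _ => (hf0Out _ (hΦi i w hw).2).trans (hΦi i w hw).1]
    simp [hpC]
  have hf1fix : ∀ w, g w = w → f1 w = f0 w := by
    intro w hw
    simp only [f1, Function.iterate_fixed hw]
    simp [hpC]
  obtain ⟨R1, hR1, hR1o⟩ := far_out (p := p) hg hper (isBounded_ball (x := (0 : ℂ)) (r := R0))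
  have hR1Out : ∀ w : ℂ, R1 ≤ ‖w‖ → w ∈ Out := fun w hw i hi => by
    have := hR1o w hw i hi
    simpa using this
  let Z : Set ℂ := {w | f1 w = 0}
  have hZk : IsCompact Z := by
    refine (isCompact_closedBall (0 : ℂ) R1).of_isClosed_subset
      (isClosed_eq hf1c continuous_const) fun w hw => ?_
    rw [mem_closedBall_zero_iff]
    by_contra h
    have hw' := hR1Out w (not_le.1 h).le
    have hw0 : f1 w = 0 := hw
    rw [hf1Out w hw'] at hw0
    exact mul_ne_zero (sub_ne_zero.2 (hner _ (hOutR hw'))) (exp_ne_zero _) hw0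
  have hZfree : ∀ z ∈ Z, g z ≠ z := by
    intro z hz h
    have hz0 : f1 z = 0 := hz
    rw [hf1fix z h] at hz0
    refine mul_ne_zero (sub_ne_zero.2 ?_) (exp_ne_zero _) hz0
    rintro rfl; exact hc h
  have hball : ∀ z, ∃ ρ > 0, z ∈ Z → ∀ i, 0 < i → i < p → ∀ w ∈ closedBall z ρ,
      g^[i] w ∉ closedBall z ρ := by
    intro z
    by_cases hz : z ∈ Z
    · obtain ⟨ρ, h1, h2⟩ := free_ball hg hp hper (hZfree z hz)
      exact ⟨ρ, h1, fun _ => h2⟩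
    · exact ⟨1, one_pos, fun h => absurd h hz⟩
  choose ρ hρ0 hρ using hball
  obtain ⟨t, htZ, htc⟩ := hZk.elim_nhds_subcover (fun z => ball z (ρ z))
    fun z _ => ball_mem_nhds z (hρ0 z)
  let A : Set ℂ := {w | ∀ z ∈ t, w ∉ ball z (ρ z)}
  have hAc : IsClosed A := by
    simp only [A, setOf_forall]
    exact isClosed_iInter fun z => isClosed_iInter fun _ => isOpen_ball.isClosed_compl
  let E0 : Set ℂ := {w | ∀ i < p, g^[i] w ∈ A}
  have hE0c : IsClosed E0 := by
    simp only [E0, setOf_forall]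
    exact isClosed_iInter fun i => isClosed_iInter fun _ => hAc.preimage (hg.iterate i)
  have hSt0 : St g p E0 := by
    obtain ⟨R2, hR2, hR2o⟩ := far_out (p := p) hg hper (B := Aᶜ) (by
      refine ((Bornology.isBounded_biUnion_finset t).2
        fun z _ => isBounded_ball (x := z) (r := ρ z)).subset fun w hw => ?_
      simp only [A, mem_compl_iff, mem_setOf_eq, not_forall, not_not] at hw
      obtain ⟨z, hz, hw⟩ := hw
      simp only [mem_iUnion]
      exact ⟨z, hz, hw⟩)
    refine ⟨hE0c, fun w hw => hsh A w hw, f1, hf1c.continuousOn, fun w hw h => ?_,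
      fun w _ => hf1g w, R0 + R1 + R2, by positivity, 0, fun w hw i hi => ?_, ?_⟩
    · have := htc h
      simp only [mem_iUnion] at this
      obtain ⟨z, hz, hwz⟩ := this
      exact hw 0 hp0 z hz hwz
    · exact not_not.1 (hR2o w (by linarith) i hi)
    · refine (hEx.mono fun w hw => ?_).congr fun w hw => ?_
      · have : R0 + R1 + R2 ≤ ‖w‖ := hw
        show R0 ≤ ‖w‖
        linarith
      · have : R0 + R1 + R2 ≤ ‖w‖ := hw
        rw [hf1Out w (hR1Out w (by linarith))]
        simp only [zero_mul, zero_add, zpow_one]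
        ring
  have hind : ∀ t' : Finset ℂ, t' ⊆ t → St g p (E0 ∪ ⋃ z ∈ t', ⋃ i ∈ Finset.range p,
      {w | g^[i] w ∈ closedBall z (ρ z)}) := by
    intro t'
    induction t' using Finset.induction_on with
    | empty => intro _; simpa using hSt0
    | insert z t' hz ih =>
      intro hsub
      have h1 := ih fun x hx => hsub (Finset.mem_insert_of_mem hx)
      have h2 := step hg hgi hp2 hper hOP hr h1 (hρ z (htZ z (hsub (Finset.mem_insert_self _ _))))
      rw [Finset.set_biUnion_insert]
      convert h2 using 1
      rw [union_assoc, union_comm (⋃ i ∈ Finset.range p, {w | g^[i] w ∈ closedBall z (ρ z)})]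
  have hfin := hind t subset_rfl
  obtain ⟨-, -, f, hfc, hf0, -, R, hR, N, -, hfR⟩ := hfin
  have huniv : (E0 ∪ ⋃ z ∈ t, ⋃ i ∈ Finset.range p,
      {w | g^[i] w ∈ closedBall z (ρ z)}) = univ := by
    refine eq_univ_of_forall fun w => ?_
    by_cases hw : w ∈ E0
    · exact Or.inl hw
    · right
      simp only [E0, A, mem_setOf_eq, not_forall, not_not] at hw
      obtain ⟨i, hi, z, hz, h⟩ := hw
      simp only [mem_iUnion]
      exact ⟨z, hz, i, Finset.mem_range.2 hi, ball_subset_closedBall h⟩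
  rw [huniv] at hfc hf0
  have hfE : Ex univ f := Ex.of_univ (continuousOn_univ.1 hfc) fun w => hf0 w (mem_univ w)
  have hk : N * p + 1 ≠ 0 := by
    intro h
    have : (p : ℤ) ∣ 1 := ⟨-N, by linarith⟩
    have h3 := Int.le_of_dvd one_pos this
    omega
  refine Ex.not_zpow hk hR (((hfE.mono (subset_univ _)).div hfR).congr fun w hw => ?_)
  have := hf0 w (mem_univ w)
  field_simp

end planar

lemma OP.comp {g g' : ℂ → ℂ} (h : OP g) (h' : OP g') (hc : Continuous g')
    (hi : Function.Injective g') : OP (fun w => g (g' w)) := by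
  intro q
  refine (((h (g' q)).comp (φ := g') (E' := {q}ᶜ) hc.continuousOn fun w hw hw' => hw
    (hi hw')).mul (h' q)).congr fun w hw => ?_
  have h1 : g' w - g' q ≠ 0 := sub_ne_zero.2 fun h => hw (hi h)
  have h2 : w - q ≠ 0 := sub_ne_zero.2 hw
  simp only [Function.comp]
  field_simp

lemma OP.iterate {g : ℂ → ℂ} (h : OP g) (hc : Continuous g) (hi : Function.Injective g) (m : ℕ) :
    OP g^[m] := by
  induction m with
  | zero =>
    intro q
    refine (Ex.const one_ne_zero).congr fun w hw => ?_
    exact div_self (sub_ne_zero.2 hw)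
  | succ m ih => exact ih.comp h hc hi

lemma planar {g : ℂ → ℂ} (hg : Continuous g) (hgi : Function.Injective g) (hOP : OP g)
    {r r' : ℂ} (hrr : r' ≠ r) (hr : g r = r) (hr' : g r' = r') :
    ∀ n : ℕ, 1 ≤ n → (∀ w, g^[n] w = w) → ∀ c, g c = c := by
  intro n
  induction n using Nat.strong_induction_on with
  | _ n ih =>
    intro hn hper
    rcases hn.eq_or_lt with h1 | h1
    · subst h1; exact hper
    · have hp := Nat.minFac_prime (n := n) (by omega)
      obtain ⟨m, hm⟩ := Nat.minFac_dvd n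
      have hm0 : 0 < m := by
        rcases Nat.eq_zero_or_pos m with h | h
        · rw [h] at hm; omega
        · exact h
      refine ih m ?_ hm0 ?_
      · have := hp.two_le
        nlinarith
      · refine planar_prime (hg.iterate m) (hgi.iterate m) hp (fun w => ?_)
          (hOP.iterate hg hgi m) hrr (Function.iterate_fixed hr m) (Function.iterate_fixed hr' m)
        rw [← Function.iterate_mul, mul_comm, ← hm, hper]

section sphere

/-- An orthonormal frame. -/
abbrev Fr := OrthonormalBasis (Fin 3) ℝ (EuclideanSpace ℝ (Fin 3))

variable (e : Fr)

/-- horizontal coordinate -/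
noncomputable def zc (b : Sphere2) : ℂ := ⟨e.repr b 0, e.repr b 1⟩
/-- vertical coordinate -/
noncomputable def tc (b : Sphere2) : ℝ := e.repr b 2

lemma zc_cont : Continuous (zc e) := by
  have : zc e = fun b : Sphere2 => ((e.repr b 0 : ℝ) : ℂ) + ((e.repr b 1 : ℝ) : ℂ) * I := by
    funext b; apply Complex.ext <;> simp [zc]
  rw [this]
  fun_prop

lemma tc_cont : Continuous (tc e) := by
  unfold tc; fun_prop

lemma zt (b : Sphere2) : zc e b * conj (zc e b) + (tc e b : ℂ) ^ 2 = 1 := by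
  have h : ‖e.repr b‖ ^ 2 = 1 := by
    rw [LinearIsometryEquiv.norm_map]
    have := b.2
    rw [mem_sphere_zero_iff_norm] at this
    rw [this]; norm_num
  rw [EuclideanSpace.norm_sq_eq, Fin.sum_univ_three] at h
  rw [Complex.mul_conj, Complex.normSq_apply]
  simp only [zc, tc, Real.norm_eq_abs, sq_abs] at h ⊢
  norm_cast
  linarith

lemma ext_c {a b : Sphere2} (h1 : zc e a = zc e b) (h2 : tc e a = tc e b) : a = b := by
  apply Subtype.ext
  apply e.repr.injective
  have h3 := congrArg Complex.re h1
  have h4 := congrArg Complex.im h1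
  simp only [zc, tc] at h2 h3 h4
  ext i
  fin_cases i
  · exact h3
  · exact h4
  · exact h2

lemma ext_neg {a b : Sphere2} (h1 : zc e a = -zc e b) (h2 : tc e a = -tc e b) : dist a b = 2 := by
  have : (a : EuclideanSpace ℝ (Fin 3)) = -b := by
    apply e.repr.injective
    have h3 := congrArg Complex.re h1
    have h4 := congrArg Complex.im h1
    simp only [zc, tc, Complex.neg_re, Complex.neg_im] at h2 h3 h4
    rw [map_neg]
    ext i
    fin_cases i
    · exact h3
    · exact h4
    · exact h2
  have hb := b.2
  rw [mem_sphere_zero_iff_norm] at hb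
  rw [Subtype.dist_eq, dist_eq_norm, this, ← neg_add', norm_neg, ← two_smul ℝ, norm_smul, hb]
  norm_num

/-- The point with given coordinates. -/
noncomputable def mkS (ζ : ℂ) (τ : ℝ) (h : normSq ζ + τ ^ 2 = 1) : Sphere2 :=
  ⟨e.repr.symm !₂[ζ.re, ζ.im, τ], by
    rw [mem_sphere_zero_iff_norm, LinearIsometryEquiv.norm_map, EuclideanSpace.norm_eq,
      Fin.sum_univ_three]
    rw [Real.sqrt_eq_one, ← h, normSq_apply]
    simp
    ring⟩

lemma zc_mk {ζ τ h} : zc e (mkS e ζ τ h) = ζ := by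
  apply Complex.ext <;> simp [zc, mkS]

lemma tc_mk {ζ τ h} : tc e (mkS e ζ τ h) = τ := by
  simp [tc, mkS]

/-- The line relation. -/
def L (b : Sphere2) (α β : ℂ) : Prop :=
  (1 - (tc e b : ℂ)) * α = zc e b * β ∧ conj (zc e b) * α = (1 + (tc e b : ℂ)) * β

lemma L_z {b : Sphere2} {α β : ℂ} (h : L e b α β) :
    zc e b * (α * conj α + β * conj β) = 2 * α * conj β := by
  obtain ⟨h1, h2⟩ := h
  have h3 := congrArg (starRingEnd ℂ) h2
  simp only [map_mul, map_add, map_one, conj_conj, conj_ofReal] at h3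
  linear_combination α * h3 - conj β * h1

lemma L_t {b : Sphere2} {α β : ℂ} (h : L e b α β) :
    tc e b * (α * conj α + β * conj β) = α * conj α - β * conj β := by
  obtain ⟨h1, h2⟩ := h
  have h3 := congrArg (starRingEnd ℂ) h2
  simp only [map_mul, map_add, map_one, conj_conj, conj_ofReal] at h3
  linear_combination -β * h3 - conj α * h1

lemma nz {α β : ℂ} (h : α ≠ 0 ∨ β ≠ 0) : α * conj α + β * conj β ≠ 0 := by
  rw [mul_conj, mul_conj]
  norm_cast
  rcases h with h | h
  · have := normSq_pos.2 h
    have := normSq_nonneg β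
    positivity
  · have := normSq_pos.2 h
    have := normSq_nonneg α
    positivity

lemma L_unique {a b : Sphere2} {α β : ℂ} (h : α ≠ 0 ∨ β ≠ 0) (ha : L e a α β) (hb : L e b α β) :
    a = b := by
  refine ext_c e (mul_right_cancel₀ (nz h) ((L_z e ha).trans (L_z e hb).symm)) ?_
  have := mul_right_cancel₀ (nz h) ((L_t e ha).trans (L_t e hb).symm)
  exact_mod_cast this

/-- A map admits a continuous lift to the tautological lines. -/
def HasLift (φ : Sphere2 → Sphere2) : Prop :=
  ∃ A B C D : Sphere2 → ℂ, Continuous A ∧ Continuous B ∧ Continuous C ∧ Continuous D ∧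
    ∀ b α β, L e b α β → (α ≠ 0 ∨ β ≠ 0) →
      L e (φ b) (A b * α + B b * β) (C b * α + D b * β) ∧
        (A b * α + B b * β ≠ 0 ∨ C b * α + D b * β ≠ 0)

lemma hasLift_id : HasLift e id := by
  refine ⟨fun _ => 1, fun _ => 0, fun _ => 0, fun _ => 1, continuous_const, continuous_const,
    continuous_const, continuous_const, fun b α β h h0 => ?_⟩
  simpa using ⟨h, h0⟩

lemma P_L (b : Sphere2) (α β : ℂ) : L e b ((1 + (tc e b : ℂ)) * α + zc e b * β)
    (conj (zc e b) * α + (1 - (tc e b : ℂ)) * β) := by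
  have h := zt e b
  constructor
  · linear_combination -α * h
  · linear_combination β * h

lemma P_nz {a b : Sphere2} {α β : ℂ} (h : α ≠ 0 ∨ β ≠ 0) (ha : L e a α β) (hd : dist a b < 2) :
    ((1 + (tc e b : ℂ)) * α + zc e b * β ≠ 0 ∨
    conj (zc e b) * α + (1 - (tc e b : ℂ)) * β ≠ 0) := by
  by_contra hcon
  push Not at hcon
  obtain ⟨h1, h2⟩ := hcon
  have h3 := congrArg (starRingEnd ℂ) h2
  simp only [map_mul, map_add, map_sub, map_one, conj_conj, conj_ofReal, map_zero] at h3
  have hz : zc e b * (α * conj α + β * conj β) = -(2 * α * conj β) := by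
    linear_combination α * h3 + conj β * h1
  have ht : tc e b * (α * conj α + β * conj β) = -(α * conj α - β * conj β) := by
    linear_combination conj α * h1 - β * h3
  refine hd.ne (ext_neg e (mul_right_cancel₀ (nz h) ?_) ?_)
  · linear_combination L_z e ha + hz
  · have : (tc e a : ℂ) = -tc e b := mul_right_cancel₀ (nz h) (by
      linear_combination L_t e ha + ht)
    exact_mod_cast this

lemma HasLift.near {φ φ' : Sphere2 → Sphere2} (hφ' : Continuous φ') (h : HasLift e φ)
    (hd : ∀ b, dist (φ b) (φ' b) < 2) : HasLift e φ' := by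
  obtain ⟨A, B, C, D, hA, hB, hC, hD, h⟩ := h
  have hz : Continuous fun b => zc e (φ' b) := (zc_cont e).comp hφ'
  have ht : Continuous fun b => (tc e (φ' b) : ℂ) :=
    continuous_ofReal.comp ((tc_cont e).comp hφ')
  have hzc : Continuous fun b => conj (zc e (φ' b)) := continuous_conj.comp hz
  refine ⟨fun b => (1 + (tc e (φ' b) : ℂ)) * A b + zc e (φ' b) * C b,
    fun b => (1 + (tc e (φ' b) : ℂ)) * B b + zc e (φ' b) * D b,
    fun b => conj (zc e (φ' b)) * A b + (1 - (tc e (φ' b) : ℂ)) * C b,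
    fun b => conj (zc e (φ' b)) * B b + (1 - (tc e (φ' b) : ℂ)) * D b,
    by fun_prop, by fun_prop, by fun_prop, by fun_prop, fun b α β hL h0 => ?_⟩
  obtain ⟨h1, h2⟩ := h b α β hL h0
  have h3 := P_L e (φ' b) (A b * α + B b * β) (C b * α + D b * β)
  have h4 := P_nz e (b := φ' b) h2 h1 (hd b)
  have e1 : (1 + (tc e (φ' b) : ℂ)) * (A b * α + B b * β) + zc e (φ' b) * (C b * α + D b * β)
    = ((1 + (tc e (φ' b) : ℂ)) * A b + zc e (φ' b) * C b) * α +
      ((1 + (tc e (φ' b) : ℂ)) * B b + zc e (φ' b) * D b) * β := by ring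
  have e2 : conj (zc e (φ' b)) * (A b * α + B b * β) + (1 - (tc e (φ' b) : ℂ)) * (C b * α + D b * β)
    = (conj (zc e (φ' b)) * A b + (1 - (tc e (φ' b) : ℂ)) * C b) * α +
      (conj (zc e (φ' b)) * B b + (1 - (tc e (φ' b) : ℂ)) * D b) * β := by ring
  rw [e1, e2] at h3 h4
  exact ⟨h3, h4⟩

lemma hasLift_of_homotopic {φ : C(Sphere2, Sphere2)}
    (h : φ.Homotopic (ContinuousMap.id _)) : HasLift e φ := by
  obtain ⟨H⟩ := h
  have hc : Continuous fun s => H.curry s := H.curry.continuous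
  have hl : IsLocallyConstant fun s => HasLift e (H.curry s) := by
    rw [IsLocallyConstant.iff_eventually_eq]
    intro s
    have hev := Metric.tendsto_nhds.1 (hc.tendsto s) 2 two_pos
    filter_upwards [hev] with s' hs'
    have hd : ∀ b, dist (H.curry s' b) (H.curry s b) < 2 := fun b =>
      (ContinuousMap.dist_apply_le_dist b).trans_lt hs'
    refine propext ⟨fun h => h.near e (H.curry s).continuous hd,
      fun h => h.near e (H.curry s').continuous fun b => ?_⟩
    rw [dist_comm]; exact hd b
  have := hl.apply_eq_of_preconnectedSpace 0 1
  have h0 : ⇑(H.curry 0) = φ := by funext b; simp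
  have h1 : ⇑(H.curry 1) = id := by funext b; simp
  rw [h0, h1] at this
  rw [this]; exact hasLift_id e

/-- The inverse of the projection to lines. -/
noncomputable def hopf (α β : ℂ) (h : normSq α + normSq β ≠ 0) : Sphere2 :=
  mkS e (2 * α * conj β / (normSq α + normSq β : ℝ))
    ((normSq α - normSq β) / (normSq α + normSq β)) (by
      rw [normSq_div, normSq_mul, normSq_mul, normSq_conj, normSq_ofReal]
      field_simp
      rw [show normSq 2 = 4 by simp [normSq_apply]; norm_num]
      ring)

lemma L_hopf {α β : ℂ} (h : normSq α + normSq β ≠ 0) : L e (hopf e α β h) α β := by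
  have h' : α * conj α + β * conj β ≠ 0 := by
    rw [mul_conj, mul_conj]; exact_mod_cast h
  unfold L hopf
  rw [zc_mk, tc_mk]
  push_cast
  simp only [map_div₀, map_mul, map_add, conj_conj, conj_ofReal, ← mul_conj, map_ofNat]
  constructor
  · field_simp
    ring
  · generalize conj α = a at *
    generalize conj β = b at *
    have h2 : a * α + b * β ≠ 0 := by rwa [mul_comm a, mul_comm b]
    have h3 : a * α + β * b ≠ 0 := by rwa [mul_comm a]
    have h4 : α * a + b * β ≠ 0 := by rwa [mul_comm b]
    field_simp
    ring

lemma hopf_cont {a b : ℂ → ℂ} (ha : Continuous a) (hb : Continuous b)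
    (h : ∀ w, normSq (a w) + normSq (b w) ≠ 0) : Continuous fun w => hopf e (a w) (b w) (h w) := by
  unfold hopf mkS
  refine Continuous.subtype_mk ?_ _
  refine e.repr.symm.continuous.comp ?_
  have h1 : Continuous fun w => normSq (a w) := continuous_normSq.comp ha
  have h2 : Continuous fun w => normSq (b w) := continuous_normSq.comp hb
  have h3 : Continuous fun w => conj (b w) := continuous_conj.comp hb
  have h4 : Continuous fun w => ((normSq (a w) + normSq (b w) : ℝ) : ℂ) :=
    continuous_ofReal.comp (h1.add h2)
  have h5 : Continuous fun w =>
      2 * a w * conj (b w) / ((normSq (a w) + normSq (b w) : ℝ) : ℂ) :=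
    ((continuous_const.mul ha).mul h3).div h4 fun w => by exact_mod_cast h w
  have h6 : Continuous fun w =>
      (normSq (a w) - normSq (b w)) / (normSq (a w) + normSq (b w)) :=
    (h1.sub h2).div (h1.add h2) h
  refine (PiLp.continuous_toLp 2 _).comp (continuous_pi fun i => ?_)
  fin_cases i
  · exact continuous_re.comp h5
  · exact continuous_im.comp h5
  · exact h6

end sphere

section finish

lemma exists_frame (x : Sphere2) : ∃ e : Fr, zc e x = 0 ∧ tc e x = 1 := by
  have hx := x.2
  rw [mem_sphere_zero_iff_norm] at hx
  obtain ⟨e, he⟩ := Orthonormal.exists_orthonormalBasis_extension_of_card_eq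
    (𝕜 := ℝ) (E := EuclideanSpace ℝ (Fin 3)) (ι := Fin 3) (by simp)
    (v := fun _ => (x : EuclideanSpace ℝ (Fin 3))) (s := {2}) (by
      rw [orthonormal_iff_ite]
      rintro ⟨i, hi⟩ ⟨j, hj⟩
      have hi' : i = 2 := hi
      have hj' : j = 2 := hj
      subst hi' hj'
      simp [hx])
  have h2 := he 2 rfl
  refine ⟨e, ?_, ?_⟩
  · apply Complex.ext <;> simp [zc, ← h2]
  · simp [tc, ← h2]

variable {e : Fr} {x : Sphere2}

lemma L_pole (hz : zc e x = 0) (ht : tc e x = 1) {α β : ℂ} : L e x α β ↔ β = 0 := by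
  unfold L
  rw [hz, ht]
  constructor
  · rintro ⟨-, h⟩
    simp only [map_zero, zero_mul, ofReal_one] at h
    linear_combination -(1 / 2 : ℂ) * h
  · rintro rfl; simp

/-- Stereographic coordinate. -/
noncomputable def sc (e : Fr) (b : Sphere2) : ℂ := zc e b / (1 - (tc e b : ℂ))

lemma tc_ne (hz : zc e x = 0) (ht : tc e x = 1) {b : Sphere2} (hb : b ≠ x) :
    1 - (tc e b : ℂ) ≠ 0 := by
  intro h
  have h1 : (tc e b : ℂ) = 1 := (sub_eq_zero.1 h).symm
  have h2 := zt e b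
  rw [h1] at h2
  have h3 : zc e b = 0 := by
    have : zc e b * conj (zc e b) = 0 := by linear_combination h2
    rw [mul_conj] at this
    exact normSq_eq_zero.1 (by exact_mod_cast this)
  exact hb (ext_c e (h3.trans hz.symm) (by rw [ht]; exact_mod_cast h1))

lemma L_sc (hz : zc e x = 0) (ht : tc e x = 1) {b : Sphere2} (hb : b ≠ x) : L e b (sc e b) 1 := by
  have h1 := tc_ne hz ht hb
  have h2 := zt e b
  unfold L sc
  constructor
  · field_simp
  · field_simp
    linear_combination h2

lemma planar_of_sphere (hz : zc e x = 0) (ht : tc e x = 1) (F : Sphere2 ≃ₜ Sphere2)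
    (hlift : HasLift e F) (hFx : F x = x) (n : ℕ) (hn : 1 ≤ n)
    (hper : ∀ x : Sphere2, F^[n] x = x) {y z : Sphere2} (hxy : x ≠ y) (hxz : x ≠ z) (hyz : y ≠ z)
    (hy : F y = y) (hz' : F z = z) (w : Sphere2) : F w = w := by
  have hn1 : ∀ w : ℂ, normSq w + normSq 1 ≠ 0 := fun w => by
    have := normSq_nonneg w
    simp only [normSq_one]
    positivity
  let h : ℂ → Sphere2 := fun w => hopf e w 1 (hn1 w)
  have hcont : Continuous h := hopf_cont e continuous_id continuous_const hn1
  have hL : ∀ w, L e (h w) w 1 := fun w => L_hopf e (hn1 w)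
  have hne : ∀ w, h w ≠ x := fun w hw => by
    have := hL w
    rw [hw, L_pole hz ht] at this
    exact one_ne_zero this
  have hs : ∀ b, b ≠ x → h (sc e b) = b := fun b hb =>
    L_unique e (Or.inr one_ne_zero) (hL _) (L_sc hz ht hb)
  have hLs : ∀ b α β, b ≠ x → L e b α β → α = sc e b * β := by
    intro b α β hb h1
    have h2 := tc_ne hz ht hb
    have h3 := h1.1
    unfold sc
    field_simp
    linear_combination h3
  have hsh : ∀ w, sc e (h w) = w := fun w => by
    have := hLs _ _ _ (hne w) (hL w)
    rw [mul_one] at this; exact this.symm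
  have hFne : ∀ w, F (h w) ≠ x := fun w hw => hne w (F.injective (hw.trans hFx.symm))
  let g : ℂ → ℂ := fun w => sc e (F (h w))
  have hg : Continuous g := by
    have h1 : Continuous fun w => F (h w) := F.continuous.comp hcont
    exact ((zc_cont e).comp h1).div
      (continuous_const.sub (continuous_ofReal.comp ((tc_cont e).comp h1)))
      fun w => tc_ne hz ht (hFne w)
  have hhg : ∀ w, h (g w) = F (h w) := fun w => hs _ (hFne w)
  have hgi : Function.Injective g := by
    intro a b hab
    have h1 : F (h a) = F (h b) := by rw [← hhg, ← hhg, hab]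
    rw [← hsh a, F.injective h1, hsh]
  have hgit : ∀ k w, h (g^[k] w) = F^[k] (h w) := by
    intro k w
    induction k with
    | zero => rfl
    | succ k ih => rw [Function.iterate_succ_apply', Function.iterate_succ_apply', hhg, ih]
  have hgper : ∀ w, g^[n] w = w := fun w => by
    rw [← hsh (g^[n] w), hgit, hper, hsh]
  obtain ⟨A, B, C, D, hA, hB, hC, hD, hm⟩ := hlift
  let ev : ℂ → ℂ := fun w => C (h w) * w + D (h w) * 1
  have hev : ∀ w, A (h w) * w + B (h w) * 1 = g w * ev w := fun w =>
    hLs _ _ _ (hFne w) (hm (h w) w 1 (hL w) (Or.inr one_ne_zero)).1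
  have hev0 : ∀ w, ev w ≠ 0 := by
    intro w hw
    rcases (hm (h w) w 1 (hL w) (Or.inr one_ne_zero)).2 with h1 | h1
    · rw [hev w, hw, mul_zero] at h1; exact h1 rfl
    · exact h1 hw
  have hevc : Continuous ev :=
    ((hC.comp hcont).mul continuous_id).add ((hD.comp hcont).mul continuous_const)
  have hevE : Ex univ ev := Ex.of_univ hevc hev0
  have hOP : OP g := by
    intro q
    have hnq : ∀ τ : ℂ, normSq (1 + q * τ) + normSq τ ≠ 0 := by
      intro τ hτ
      have h1 := normSq_nonneg (1 + q * τ)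
      have h2 := normSq_nonneg τ
      have h3 : τ = 0 := normSq_eq_zero.1 (by linarith)
      rw [h3] at hτ
      simp at hτ
    let k : ℂ → Sphere2 := fun τ => hopf e (1 + q * τ) τ (hnq τ)
    have hkc : Continuous k := hopf_cont e (by fun_prop) continuous_id hnq
    have hkL : ∀ τ, L e (k τ) (1 + q * τ) τ := fun τ => L_hopf e (hnq τ)
    have hk0 : k 0 = x := by
      have h1 := hkL 0
      refine L_unique e (α := 1) (β := 0) (Or.inl one_ne_zero) ?_ ((L_pole hz ht).2 rfl)
      simpa using h1
    let Df : ℂ → ℂ := fun τ => (A (k τ) * (1 + q * τ) + B (k τ) * τ) -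
      g q * (C (k τ) * (1 + q * τ) + D (k τ) * τ)
    have hA' : Continuous fun τ => A (k τ) := hA.comp hkc
    have hB' : Continuous fun τ => B (k τ) := hB.comp hkc
    have hC' : Continuous fun τ => C (k τ) := hC.comp hkc
    have hD' : Continuous fun τ => D (k τ) := hD.comp hkc
    have hDc : Continuous Df := by fun_prop
    have hkw : ∀ w, w ≠ q → k (w - q)⁻¹ = h w := by
      intro w hw
      have hwq := sub_ne_zero.2 hw
      refine L_unique e (α := w) (β := 1) (Or.inr one_ne_zero) ?_ (hL w)
      obtain ⟨h1, h2⟩ := hkL (w - q)⁻¹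
      have h3 : w = (w - q) * (1 + q * (w - q)⁻¹) := by field_simp; ring
      have h4 : (1 : ℂ) = (w - q) * (w - q)⁻¹ := by field_simp
      constructor
      · linear_combination (w - q) * h1 + (1 - (tc e (k (w - q)⁻¹) : ℂ)) * h3 -
          zc e (k (w - q)⁻¹) * h4
      · linear_combination (w - q) * h2 + conj (zc e (k (w - q)⁻¹)) * h3 -
          (1 + (tc e (k (w - q)⁻¹) : ℂ)) * h4
    have hDw : ∀ w, w ≠ q → Df (w - q)⁻¹ = (w - q)⁻¹ * (ev w * (g w - g q)) := by
      intro w hw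
      have hwq := sub_ne_zero.2 hw
      have h3 : 1 + q * (w - q)⁻¹ = (w - q)⁻¹ * w := by field_simp; ring
      simp only [Df]
      rw [hkw w hw, h3]
      have h5 := hev w
      simp only [ev] at h5 ⊢
      linear_combination (w - q)⁻¹ * h5
    have hD0 : ∀ τ, Df τ ≠ 0 := by
      intro τ
      by_cases hτ : τ = 0
      · subst hτ
        obtain ⟨h1, h2⟩ := hm (k 0) _ _ (hkL 0) (Or.inl (by simp))
        simp only [Df]
        rw [hk0] at h1 h2 ⊢
        rw [hFx, L_pole hz ht] at h1
        rw [h1] at h2 ⊢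
        simpa using h2
      · have hwq : q + τ⁻¹ ≠ q := by simpa using hτ
        have h1 := hDw _ hwq
        rw [add_sub_cancel_left, inv_inv] at h1
        rw [h1]
        exact mul_ne_zero hτ (mul_ne_zero (hev0 _) (sub_ne_zero.2 fun h => hwq (hgi h)))
    have hDE : Ex univ Df := Ex.of_univ hDc hD0
    have hφ : ContinuousOn (fun w : ℂ => (w - q)⁻¹) {q}ᶜ :=
      (continuous_id.sub continuous_const).continuousOn.inv₀ fun w hw => sub_ne_zero.2 hw
    refine ((hDE.comp hφ fun _ _ => mem_univ _).div (hevE.mono (subset_univ _))).congr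
      fun w hw => ?_
    have h1 := hDw w hw
    have h2 := hev0 w
    have h3 : w - q ≠ 0 := sub_ne_zero.2 hw
    simp only [h1]
    field_simp
  have hfix : ∀ b, b ≠ x → F b = b → g (sc e b) = sc e b := fun b hb hFb => by
    simp only [g]
    rw [hs b hb, hFb]
  have hall := planar hg hgi hOP (r := sc e y) (r' := sc e z) (fun h1 => hyz (by
    rw [← hs y hxy.symm, ← hs z hxz.symm, h1])) (hfix y hxy.symm hy) (hfix z hxz.symm hz')
    n hn hgper
  by_cases hw : w = x
  · rw [hw, hFx]
  · have := hhg (sc e w)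
    rw [hall, hs w hw] at this
    exact this.symm

end finish

/-- A periodic orientation-preserving homeomorphism of the 2-sphere with at least three
fixed points is the identity. -/
theorem periodic_orientation_preserving_homeo_with_three_fixed_points_eq_id
    (F : Sphere2 ≃ₜ Sphere2) (n : ℕ) (hn : 1 ≤ n)
    (hper : ∀ x : Sphere2, F^[n] x = x)
    (hor : OrientPreserving F)
    (x y z : Sphere2) (hxy : x ≠ y) (hxz : x ≠ z) (hyz : y ≠ z)
    (hx : F x = x) (hy : F y = y) (hz : F z = z) :
    ∀ w : Sphere2, F w = w := by
  obtain ⟨e, h0, h1⟩ := exists_frame x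
  exact planar_of_sphere h0 h1 F (hasLift_of_homotopic e hor) hx n hn hper hxy hxz hyz hy hz
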